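/- For all PoCTL state formulae Φ,Ψ and every rational r∈[0,1], the following equivalences of PoCTL state formulae hold: ¬Po_{≥r}(◯Φ)=Ne_{>1−r}(◯¬Φ); ¬Po_{≥r}(Φ⊔Ψ)=Ne_{>1−r}(¬Φ𝐑¬Ψ); ¬Po_{≥r}(Φ𝐑Ψ)=Ne_{>1−r}(¬Φ⊔¬Ψ); and ¬Po_{≥r}(◇Φ)=Ne_{>1−r}(□¬Φ). -/

import Mathlib

open Set

/-- An interval `J ⊆ [0,1]` with rational bounds. -/
inductive RatInterval : Type where
  | icc (u v : ℚ)
  | ioc (u v : ℚ)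
  | ico (u v : ℚ)
  | ioo (u v : ℚ)
  deriving DecidableEq

/-- Membership of a real number in a rational-bounded interval. -/
def RatInterval.mem : RatInterval → ℝ → Prop
  | .icc u v, x => (u : ℝ) ≤ x ∧ x ≤ (v : ℝ)
  | .ioc u v, x => (u : ℝ) < x ∧ x ≤ (v : ℝ)
  | .ico u v, x => (u : ℝ) ≤ x ∧ x < (v : ℝ)
  | .ioo u v, x => (u : ℝ) < x ∧ x < (v : ℝ)

mutual
/-- PoCTL state formulae (including the derived connective `∨`, the necessity
operator `Ne_J`, and in path formulae the operators `𝐑`, `◇`). -/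
inductive SF (A : Type) : Type where
  | tt : SF A
  | atom : A → SF A
  | and : SF A → SF A → SF A
  | or : SF A → SF A → SF A
  | not : SF A → SF A
  | po : RatInterval → PF A → SF A
  | ne : RatInterval → PF A → SF A

/-- PoCTL path formulae. -/
inductive PF (A : Type) : Type where
  | next : SF A → PF A
  | untl : SF A → SF A → PF A
  | buntl : ℕ → SF A → SF A → PF A
  | rel : SF A → SF A → PF A
  | ev : SF A → PF A
  | box : SF A → PF A
end

/-- `Po_{≥r}(φ)`. -/
def poGe {A : Type} (r : ℚ) (φ : PF A) : SF A := .po (.icc r 1) φ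
/-- `Po_{>r}(φ)`. -/
def poGt {A : Type} (r : ℚ) (φ : PF A) : SF A := .po (.ioc r 1) φ
/-- `Po_{≤r}(φ)`. -/
def poLe {A : Type} (r : ℚ) (φ : PF A) : SF A := .po (.icc 0 r) φ
/-- `Po_{<r}(φ)`. -/
def poLt {A : Type} (r : ℚ) (φ : PF A) : SF A := .po (.ico 0 r) φ
/-- `Ne_{≥r}(φ)`. -/
def neGe {A : Type} (r : ℚ) (φ : PF A) : SF A := .ne (.icc r 1) φ
/-- `Ne_{>r}(φ)`. -/
def neGt {A : Type} (r : ℚ) (φ : PF A) : SF A := .ne (.ioc r 1) φ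
/-- `Ne_{≤r}(φ)`. -/
def neLe {A : Type} (r : ℚ) (φ : PF A) : SF A := .ne (.icc 0 r) φ
/-- `Ne_{<r}(φ)`. -/
def neLt {A : Type} (r : ℚ) (φ : PF A) : SF A := .ne (.ico 0 r) φ
/-- A possibilistic Kripke structure over states `S` and atomic propositions `A`. -/
structure PKS (S A : Type) where
  P : S → S → ℝ
  init : S → ℝ
  L : S → Set A
  countable : Countable S
  nonempty : Nonempty S
  P_nonneg : ∀ s t, 0 ≤ P s t
  P_le_one : ∀ s t, P s t ≤ 1
  P_sup : ∀ s, (⨆ t, P s t) = 1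
  init_nonneg : ∀ s, 0 ≤ init s
  init_le_one : ∀ s, init s ≤ 1
  init_sup : (⨆ s, init s) = 1

variable {S A : Type}

/-- `π` is a path of `M`: all transition possibilities along `π` are positive. -/
def PKS.IsPath (M : PKS S A) (π : ℕ → S) : Prop := ∀ i, 0 < M.P (π i) (π (i + 1))

/-- The set of all paths of `M`. -/
def PKS.Paths (M : PKS S A) : Set (ℕ → S) := {π | M.IsPath π}

/-- `Po^{M_s}(π) = inf { P(sᵢ,sᵢ₊₁) : i ≥ 0 }`, the possibility of a path in the
structure with unique initial state `π 0`. -/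
noncomputable def PKS.poPathFrom (M : PKS S A) (π : ℕ → S) : ℝ :=
  ⨅ i, M.P (π i) (π (i + 1))

mutual
/-- Satisfaction of PoCTL state formulae at a state of a PKS. -/
def SF.Sat (M : PKS S A) (s : S) : SF A → Prop
  | .tt => True
  | .atom a => a ∈ M.L s
  | .and Φ Ψ => SF.Sat M s Φ ∧ SF.Sat M s Ψ
  | .or Φ Ψ => SF.Sat M s Φ ∨ SF.Sat M s Ψ
  | .not Φ => ¬ SF.Sat M s Φ
  | .po J φ => J.mem (sSup {x : ℝ | ∃ π : ℕ → S,
      M.IsPath π ∧ π 0 = s ∧ PF.Sat M π φ ∧ x = M.poPathFrom π})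
  | .ne J φ => J.mem (1 - sSup {x : ℝ | ∃ π : ℕ → S,
      M.IsPath π ∧ π 0 = s ∧ ¬ PF.Sat M π φ ∧ x = M.poPathFrom π})

/-- Satisfaction of PoCTL path formulae along a path of a PKS. -/
def PF.Sat (M : PKS S A) (π : ℕ → S) : PF A → Prop
  | .next Φ => SF.Sat M (π 1) Φ
  | .untl Φ Ψ => ∃ k, SF.Sat M (π k) Ψ ∧ ∀ i < k, SF.Sat M (π i) Φ
  | .buntl n Φ Ψ => ∃ k ≤ n, SF.Sat M (π k) Ψ ∧ ∀ i < k, SF.Sat M (π i) Φ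
  | .rel Φ Ψ => ∀ j, ¬ SF.Sat M (π j) Ψ → ∃ k < j, SF.Sat M (π k) Φ
  | .ev Φ => ∃ j, SF.Sat M (π j) Φ
  | .box Φ => ∀ j, SF.Sat M (π j) Φ
end

/-- Equivalence of PoCTL state formulae: same truth value at every state of every PKS. -/
def SFEquiv {A : Type} (Φ Ψ : SF A) : Prop :=
  ∀ (S : Type) (M : PKS S A) (s : S), SF.Sat M s Φ ↔ SF.Sat M s Ψ

theorem PKS.poPathFrom_nonneg (M : PKS S A) (π : ℕ → S) : 0 ≤ M.poPathFrom π :=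
  Real.iInf_nonneg fun _ => M.P_nonneg _ _

theorem PKS.poPathFrom_le_one (M : PKS S A) (π : ℕ → S) : M.poPathFrom π ≤ 1 :=
  (ciInf_le ⟨0, by rintro _ ⟨i, rfl⟩; exact M.P_nonneg _ _⟩ 0).trans (M.P_le_one _ _)

/-- `¬Po_{≥r}(φ) = Ne_{>1-r}(ψ)` whenever the paths violating `ψ` are those satisfying `φ`. -/
theorem sfEquiv_not_poGe_neGt {A : Type} (r : ℚ) {φ ψ : PF A}
    (h : ∀ (S : Type) (M : PKS S A) (π : ℕ → S), ¬ PF.Sat M π ψ ↔ PF.Sat M π φ) :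
    SFEquiv (SF.not (poGe r φ)) (neGt (1 - r) ψ) := by
  intro S M s
  simp only [poGe, neGt, SF.Sat, h, RatInterval.mem]
  set E := {x : ℝ | ∃ π : ℕ → S, M.IsPath π ∧ π 0 = s ∧ PF.Sat M π φ ∧ x = M.poPathFrom π}
  have hE0 : 0 ≤ sSup E := by
    refine Real.sSup_nonneg ?_
    rintro _ ⟨π, -, -, -, rfl⟩
    exact M.poPathFrom_nonneg π
  have hE1 : sSup E ≤ 1 := by
    refine Real.sSup_le ?_ zero_le_one
    rintro _ ⟨π, -, -, -, rfl⟩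
    exact M.poPathFrom_le_one π
  push_cast
  constructor
  · intro hn
    have : sSup E < r := not_le.mp fun hr => hn ⟨hr, hE1⟩
    constructor <;> linarith
  · rintro ⟨hlt, -⟩ ⟨hle, -⟩
    linarith

/-- **Proposition.** For all PoCTL state formulae `Φ, Ψ` and every rational `r ∈ [0,1]`:
`¬Po_{≥r}(◯Φ) = Ne_{>1−r}(◯¬Φ)`, `¬Po_{≥r}(Φ⊔Ψ) = Ne_{>1−r}(¬Φ𝐑¬Ψ)`,
`¬Po_{≥r}(Φ𝐑Ψ) = Ne_{>1−r}(¬Φ⊔¬Ψ)`, `¬Po_{≥r}(◇Φ) = Ne_{>1−r}(□¬Φ)`. -/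
theorem not_poGe_duality {A : Type} (Φ Ψ : SF A) (r : ℚ) (h0 : 0 ≤ r) (h1 : r ≤ 1) :
    SFEquiv (SF.not (poGe r (.next Φ))) (neGt (1 - r) (.next (.not Φ))) ∧
    SFEquiv (SF.not (poGe r (.untl Φ Ψ))) (neGt (1 - r) (.rel (.not Φ) (.not Ψ))) ∧
    SFEquiv (SF.not (poGe r (.rel Φ Ψ))) (neGt (1 - r) (.untl (.not Φ) (.not Ψ))) ∧
    SFEquiv (SF.not (poGe r (.ev Φ))) (neGt (1 - r) (.box (.not Φ))) := by
  refine ⟨sfEquiv_not_poGe_neGt r ?_, sfEquiv_not_poGe_neGt r ?_,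
    sfEquiv_not_poGe_neGt r ?_, sfEquiv_not_poGe_neGt r ?_⟩ <;> intro S M π
  · simp only [PF.Sat, SF.Sat, not_not]
  · simp only [PF.Sat, SF.Sat, not_not]
    push Not
    rfl
  · simp only [PF.Sat, SF.Sat]
    push Not
    rfl
  · simp only [PF.Sat, SF.Sat, not_forall, not_not]
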